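/- Let A be a finite nonempty set, P : A × A → ℝ with P_{j,k} ≥ 0 for all j, k, and u : A → ℝ with u_j > 0 for all j and Σ_{j∈A} u_j P_{j,k} = u_k for all k ∈ A (u is a positive left eigenvector of P for eigenvalue 1). Let ε ∈ (0, 1], and let v, C : A → ℝ satisfy v_j ≥ 0, C_j ≥ 0 and v_j ≤ (1 − ε)·Σ_{k∈A} P_{j,k} v_k + C_j for all j ∈ A. Then v_j ≤ (Σ_{k∈A} u_k C_k) / (ε·u_j) for every j ∈ A. -/

import Mathlib

/-- Pairing a left eigenvector `u` of `P` for the eigenvalue `1` with `P v` gives the pairing of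
`u` with `v`. -/
theorem sum_mul_sum_of_left_eigenvector {A R : Type*} [Fintype A] [CommSemiring R]
    {P : A → A → R} {u : A → R} (huP : ∀ k, ∑ j, u j * P j k = u k) (v : A → R) :
    ∑ j, u j * ∑ k, P j k * v k = ∑ k, u k * v k := by
  simp_rw [Finset.mul_sum]
  rw [Finset.sum_comm]
  refine Finset.sum_congr rfl fun k _ => ?_
  rw [← huP k, Finset.sum_mul]
  exact Finset.sum_congr rfl fun j _ => (mul_assoc _ _ _).symm

/-- Perron–Frobenius step: a vector inequality with a positive left eigenvector
yields a componentwise bound. -/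
theorem stmt_9 (A : Type*) [Fintype A] [Nonempty A]
    (P : A → A → ℝ) (hP : ∀ j k, 0 ≤ P j k)
    (u : A → ℝ) (hu : ∀ j, 0 < u j) (huP : ∀ k, ∑ j, u j * P j k = u k)
    (ε : ℝ) (hε : ε ∈ Set.Ioc (0 : ℝ) 1)
    (v C : A → ℝ) (hv : ∀ j, 0 ≤ v j) (hC : ∀ j, 0 ≤ C j)
    (hineq : ∀ j, v j ≤ (1 - ε) * (∑ k, P j k * v k) + C j) :
    ∀ j, v j ≤ (∑ k, u k * C k) / (ε * u j) := by
  intro j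
  have hsum : ∑ i, u i * v i ≤ (1 - ε) * ∑ i, u i * v i + ∑ i, u i * C i := by
    calc ∑ i, u i * v i
        ≤ ∑ i, u i * ((1 - ε) * (∑ k, P i k * v k) + C i) :=
          Finset.sum_le_sum fun i _ => mul_le_mul_of_nonneg_left (hineq i) (hu i).le
      _ = (1 - ε) * ∑ i, u i * (∑ k, P i k * v k) + ∑ i, u i * C i := by
          rw [Finset.mul_sum, ← Finset.sum_add_distrib]
          exact Finset.sum_congr rfl fun i _ => by ring
      _ = (1 - ε) * ∑ i, u i * v i + ∑ i, u i * C i := by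
          rw [sum_mul_sum_of_left_eigenvector huP]
  have hj : u j * v j ≤ ∑ i, u i * v i :=
    Finset.single_le_sum (f := fun i => u i * v i)
      (fun i _ => mul_nonneg (hu i).le (hv i)) (Finset.mem_univ j)
  rw [le_div_iff₀ (mul_pos hε.1 (hu j))]
  linarith [mul_le_mul_of_nonneg_left hj hε.1.le]
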